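/- arXiv:2602.10512 — 2 statements merged into one kernel-verified Lean document; each statement's English description precedes it below -/
import Mathlib

section
/- (Misranking forces a KL lower bound.) Let A be a finite nonempty set, let q and π be probability vectors on A with π strictly positive, and let 1 ≤ k ≤ |A|. If S_π is a top-k set for π, S_q is a top-k set for q, and S_π ≠ S_q, then KL(q‖π) := Σ_{a ∈ A} q(a) log(q(a)/π(a)) ≥ Δ_k(q)² / 8. -/
/-- `S` is a top-`k` set for the probability vector `p` on the finite type `A`:
it has `k` elements and `p` is at least as large on `S` as on its complement. -/
def IsTopK {A : Type*} [Fintype A] (p : A → ℝ) (k : ℕ) (S : Finset A) : Prop :=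
  S.card = k ∧ ∀ a ∈ S, ∀ b ∉ S, p b ≤ p a

/-- The `i`-th largest value (1-indexed) among the values of `p : A → ℝ`, with the
convention that it is `0` when `i` is out of range. -/
noncomputable def orderStat {A : Type*} [Fintype A] (p : A → ℝ) (i : ℕ) : ℝ :=
  let l := ((Finset.univ : Finset A).val.map p).sort (· ≤ ·)
  if 1 ≤ i ∧ i ≤ l.length then l.getD (l.length - i) 0 else 0

/-- The top-`k` margin `Δ_k(p) := p_(k) − p_(k+1)` (with `p_(k+1) := 0` when `|A| = k`). -/
noncomputable def gapK {A : Type*} [Fintype A] (p : A → ℝ) (k : ℕ) : ℝ :=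
  orderStat p k - orderStat p (k + 1)

/-- The Kullback–Leibler divergence `KL(q‖π) := Σ_a q(a) log(q(a)/π(a))` of probability
vectors on the finite type `A` (with `0·log 0 = 0`, as is automatic here). -/
noncomputable def KLfin {A : Type*} [Fintype A] (q π : A → ℝ) : ℝ :=
  ∑ a, q a * Real.log (q a / π a)

/-- In an ascending list, everything from an entry exceeding `c` onwards exceeds `c`. -/
theorem length_sub_le_countP_lt {l : List ℝ} (hl : l.Pairwise (· ≤ ·)) {i : ℕ}
    (hi : i < l.length) {c : ℝ} (hc : c < l[i]) :
    l.length - i ≤ l.countP (fun x => c < x) := by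
  have h : (l.drop i).countP (fun x => c < x) = (l.drop i).length := by
    rw [List.countP_eq_length]
    intro x hx
    obtain ⟨j, hj, rfl⟩ := List.mem_iff_getElem.mp hx
    rw [List.getElem_drop]
    rw [List.length_drop] at hj
    exact decide_eq_true
      (hc.trans_le (hl.rel_get_of_le (a := ⟨i, hi⟩) (b := ⟨i + j, by omega⟩) (by simp)))
  rw [← List.length_drop, ← h]
  exact (List.drop_sublist i l).countP_le

/-- In an ascending list, everything up to an entry below `c` is below `c`. -/
theorem succ_le_countP_gt {l : List ℝ} (hl : l.Pairwise (· ≤ ·)) {i : ℕ}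
    (hi : i < l.length) {c : ℝ} (hc : l[i] < c) :
    i + 1 ≤ l.countP (fun x => x < c) := by
  have h : (l.take (i + 1)).countP (fun x => x < c) = (l.take (i + 1)).length := by
    rw [List.countP_eq_length]
    intro x hx
    obtain ⟨j, hj, rfl⟩ := List.mem_iff_getElem.mp hx
    rw [List.getElem_take]
    rw [List.length_take] at hj
    exact decide_eq_true
      ((hl.rel_get_of_le (a := ⟨j, by omega⟩) (b := ⟨i, hi⟩)
        (by rw [Fin.mk_le_mk]; omega)).trans_lt hc)
  have hlen : (l.take (i + 1)).length = i + 1 := by rw [List.length_take]; omega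
  rw [← hlen, ← h]
  exact (List.take_sublist _ l).countP_le

section OrderStat

variable {A : Type*} [Fintype A] (p : A → ℝ)

theorem pairwise_sort_values :
    (((Finset.univ : Finset A).val.map p).sort (· ≤ ·)).Pairwise (· ≤ ·) :=
  Multiset.pairwise_sort _ _

theorem length_sort_values :
    (((Finset.univ : Finset A).val.map p).sort (· ≤ ·)).length = Fintype.card A := by
  simp

theorem countP_sort_values (P : ℝ → Prop) [DecidablePred P] :
    (((Finset.univ : Finset A).val.map p).sort (· ≤ ·)).countP (fun x => P x) =
      (Finset.univ.filter fun a => P (p a)).card := by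
  rw [← Multiset.coe_countP, Multiset.sort_eq, Multiset.countP_map]
  rfl

theorem orderStat_eq_getElem {i : ℕ} (h1 : 1 ≤ i) (h2 : i ≤ Fintype.card A) :
    orderStat p i = (((Finset.univ : Finset A).val.map p).sort (· ≤ ·))[Fintype.card A - i]'(by
      rw [length_sort_values]; omega) := by
  have hlen := length_sort_values p
  unfold orderStat
  simp only
  rw [if_pos ⟨h1, hlen.symm ▸ h2⟩, List.getD_eq_getElem _ _ (by omega)]
  simp only [hlen]

theorem orderStat_succ_le {k : ℕ} (h1 : 1 ≤ k) (h2 : k + 1 ≤ Fintype.card A) :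
    orderStat p (k + 1) ≤ orderStat p k := by
  have hlen := length_sort_values p
  rw [orderStat_eq_getElem p h1 (by omega), orderStat_eq_getElem p (by omega) h2]
  exact (pairwise_sort_values p).rel_get_of_le (a := ⟨Fintype.card A - (k + 1), by omega⟩)
    (b := ⟨Fintype.card A - k, by omega⟩) (by rw [Fin.mk_le_mk]; omega)

variable {p}

theorem IsTopK.orderStat_le {k : ℕ} {S : Finset A} (hS : IsTopK p k S) {a : A} (ha : a ∈ S) :
    orderStat p k ≤ p a := by
  classical
  have h1 : 1 ≤ k := hS.1 ▸ Finset.card_pos.mpr ⟨a, ha⟩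
  have h2 : k ≤ Fintype.card A := hS.1 ▸ Finset.card_le_univ S
  have hlen := length_sort_values p
  rw [orderStat_eq_getElem p h1 h2]
  by_contra! hlt
  have hcount := length_sub_le_countP_lt (pairwise_sort_values p) (by omega) hlt
  rw [countP_sort_values p (fun x => p a < x), hlen] at hcount
  have hsub : (Finset.univ.filter fun x => p a < p x) ⊆ S.erase a := by
    intro x hx
    have hx' : p a < p x := (Finset.mem_filter.mp hx).2
    refine Finset.mem_erase.mpr ⟨fun h => (h ▸ hx').false, ?_⟩
    by_contra hxS
    exact (hS.2 a ha x hxS).not_gt hx'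
  have hcard := Finset.card_le_card hsub
  rw [Finset.card_erase_of_mem ha, hS.1] at hcard
  omega

theorem IsTopK.le_orderStat_succ {k : ℕ} {S : Finset A} (hS : IsTopK p k S) {b : A}
    (hb : b ∉ S) : p b ≤ orderStat p (k + 1) := by
  classical
  have hcompl : Sᶜ.card = Fintype.card A - k := by rw [Finset.card_compl, hS.1]
  have hb' : b ∈ Sᶜ := Finset.mem_compl.mpr hb
  have hpos : 0 < Sᶜ.card := Finset.card_pos.mpr ⟨b, hb'⟩
  have hlen := length_sort_values p
  rw [orderStat_eq_getElem p (by omega) (by omega)]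
  by_contra! hlt
  have hcount := succ_le_countP_gt (pairwise_sort_values p) (by omega) hlt
  rw [countP_sort_values p (fun x => x < p b)] at hcount
  have hsub : (Finset.univ.filter fun x => p x < p b) ⊆ Sᶜ.erase b := by
    intro x hx
    have hx' : p x < p b := (Finset.mem_filter.mp hx).2
    refine Finset.mem_erase.mpr ⟨fun h => (h ▸ hx').false, Finset.mem_compl.mpr fun hxS => ?_⟩
    exact (hS.2 x hxS b hb).not_gt hx'
  have hcard := Finset.card_le_card hsub
  rw [Finset.card_erase_of_mem hb'] at hcard
  omega

end OrderStat

/-- Pointwise comparison of the relative entropy with the squared Hellinger distance. -/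
theorem sq_sqrt_sub_sqrt_le_mul_log {x y : ℝ} (hx : 0 ≤ x) (hy : 0 < y) :
    (√x - √y) ^ 2 ≤ x * Real.log (x / y) - x + y := by
  rcases hx.eq_or_lt with rfl | hx
  · simp [Real.sq_sqrt hy.le]
  have hsx := Real.sqrt_pos.mpr hx
  have hsy := Real.sqrt_pos.mpr hy
  have hlog : Real.log (x / y) = -(2 * Real.log (√y / √x)) := by
    rw [Real.log_div hx.ne' hy.ne', Real.log_div hsy.ne' hsx.ne', Real.log_sqrt hx.le,
      Real.log_sqrt hy.le]
    ring
  have hle : Real.log (√y / √x) ≤ √y / √x - 1 := Real.log_le_sub_one_of_pos (by positivity)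
  have hmul : x * (√y / √x) = √x * √y := by
    nth_rewrite 1 [← Real.mul_self_sqrt hx.le]
    field_simp
  rw [hlog]
  nlinarith [mul_le_mul_of_nonneg_left hle hx.le, Real.sq_sqrt hx.le, Real.sq_sqrt hy.le]

/-- A two-point Pinsker-type inequality. -/
theorem sq_le_four_mul_KLfin {A : Type*} [Fintype A] [DecidableEq A] {q π : A → ℝ}
    (hq0 : ∀ a, 0 ≤ q a) (hq1 : ∑ a, q a = 1) (hπ0 : ∀ a, 0 < π a) (hπ1 : ∑ a, π a = 1)
    {a b : A} (hab : a ≠ b) :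
    ((q a - π a) - (q b - π b)) ^ 2 ≤ 4 * KLfin q π := by
  have pair_le (f : A → ℝ) (hf : ∀ x, 0 ≤ f x) : f a + f b ≤ ∑ x, f x := by
    rw [← Finset.sum_pair hab]
    exact Finset.sum_le_sum_of_subset_of_nonneg (Finset.subset_univ _) fun x _ _ => hf x
  have hKL : (√(q a) - √(π a)) ^ 2 + (√(q b) - √(π b)) ^ 2 ≤ KLfin q π := by
    refine (pair_le (fun x => (√(q x) - √(π x)) ^ 2) fun x => sq_nonneg _).trans ?_
    refine (Finset.sum_le_sum fun x _ => sq_sqrt_sub_sqrt_le_mul_log (hq0 x) (hπ0 x)).trans ?_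
    rw [Finset.sum_add_distrib, Finset.sum_sub_distrib, hq1, hπ1, KLfin]
    linarith
  have hq := pair_le q hq0
  have hπ := pair_le π fun x => (hπ0 x).le
  rw [hq1] at hq
  rw [hπ1] at hπ
  have hqa := Real.sq_sqrt (hq0 a)
  have hqb := Real.sq_sqrt (hq0 b)
  have hπa := Real.sq_sqrt (hπ0 a).le
  have hπb := Real.sq_sqrt (hπ0 b).le
  rw [← hqa, ← hqb] at hq
  rw [← hπa, ← hπb] at hπ
  rw [← hqa, ← hqb, ← hπa, ← hπb]
  generalize √(q a) = s at *
  generalize √(q b) = t at *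
  generalize √(π a) = u at *
  generalize √(π b) = v at *
  have hsum : (s + u) ^ 2 + (t + v) ^ 2 ≤ 4 := by
    nlinarith [sq_nonneg (s - u), sq_nonneg (t - v)]
  calc (s ^ 2 - u ^ 2 - (t ^ 2 - v ^ 2)) ^ 2
      ≤ ((s + u) ^ 2 + (t + v) ^ 2) * ((s - u) ^ 2 + (t - v) ^ 2) := by
        nlinarith [sq_nonneg ((s + u) * (t - v) + (t + v) * (s - u))]
    _ ≤ 4 * ((s - u) ^ 2 + (t - v) ^ 2) := by gcongr
    _ ≤ 4 * KLfin q π := by gcongr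

/-- **Misranking forces a KL lower bound.** If `π` is strictly positive, `Sπ` is a
top-`k` set for `π`, `Sq` is a top-`k` set for `q`, and `Sπ ≠ Sq`, then
`KL(q‖π) ≥ Δ_k(q)²/8`. -/
theorem stmt11 {A : Type*} [Fintype A] [Nonempty A] [DecidableEq A]
    (q π : A → ℝ) (hq0 : ∀ a, 0 ≤ q a) (hq1 : ∑ a, q a = 1)
    (hπ0 : ∀ a, 0 < π a) (hπ1 : ∑ a, π a = 1)
    (k : ℕ) (hk1 : 1 ≤ k) (hk2 : k ≤ Fintype.card A)
    (Sπ Sq : Finset A) (hSπ : IsTopK π k Sπ) (hSq : IsTopK q k Sq) (hne : Sπ ≠ Sq) :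
    gapK q k ^ 2 / 8 ≤ KLfin q π := by
  obtain ⟨a, haq, haπ⟩ : ∃ a ∈ Sq, a ∉ Sπ := by
    by_contra! h
    exact hne (Finset.eq_of_subset_of_card_le h (by rw [hSπ.1, hSq.1])).symm
  obtain ⟨b, hbπ, hbq⟩ : ∃ b ∈ Sπ, b ∉ Sq := by
    by_contra! h
    exact hne (Finset.eq_of_subset_of_card_le h (by rw [hSπ.1, hSq.1]))
  have hcard : k + 1 ≤ Fintype.card A := by
    rw [← hSq.1]
    exact Finset.card_lt_univ_of_notMem hbq
  have hgap0 : 0 ≤ gapK q k := sub_nonneg.mpr (orderStat_succ_le q hk1 hcard)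
  have hgap : gapK q k ≤ (q a - π a) - (q b - π b) := by
    have h1 := hSq.orderStat_le haq
    have h2 := hSq.le_orderStat_succ hbq
    have h3 := hSπ.2 b hbπ a haπ
    unfold gapK
    linarith
  have hab : a ≠ b := fun h => hbq (h ▸ haq)
  have hsq := sq_le_four_mul_KLfin hq0 hq1 hπ0 hπ1 hab
  have hgapsq := pow_le_pow_left₀ hgap0 hgap 2
  linarith [sq_nonneg (gapK q k)]
end

section
/- (Top-k success under a Tsybakov margin condition; flat case.) Consider a deterministic proving MDP with generator policy q, and let Q be a distribution over successful traces τ = (S₀, A₀, S₁, A₁, …, S_L) with S_L ∈ G, random length L ≤ T, conditional action law A_t ∼ q(·|S_t) given S_t (restricted and normalized to a finite candidate set Γ(S_t) of size M), and K := E[L] < ∞. Let ν be the time-mixture state law defined by E_{S∼ν}[g(S)] = (1/K)·E_Q[Σ_{t=0}^{L−1} g(S_t)]. Let π be any policy, and assume the margin condition P_{S∼ν}(Δ_k(q_Γ(·|S)) ≤ u) ≤ C₀ u^β for all u > 0, with k ≤ M, C₀ > 0, β > 0. Define KL̄(π) := E_{S∼ν}[KL(q_Γ(·|S)‖π_Γ(·|S))].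 Then the probability under Q of the coverage event {A_t ∈ Top_k(π(·|S_t)) for all 0 ≤ t < L} is at least 1 − K·E_{S∼ν}[1 − m_k(q_Γ(·|S))] − K·C_{β,C₀}·KL̄(π)^{β/(β+2)}, where C_{β,C₀} depends only on β and C₀. In particular, any top-k proof search that succeeds whenever the coverage event holds has success probability at least this bound. -/
open MeasureTheory

/-- The `i`-th largest value (1-indexed) of `p` on the finite candidate set `t`
(counted with multiplicity), with the convention that it is `0` when `i` is out of
range (in particular `p_(|t|+1) = 0`). -/
noncomputable def orderStatOn {A : Type*} (t : Finset A) (p : A → ℝ) (i : ℕ) : ℝ :=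
  let l := (t.val.map p).sort (· ≤ ·)
  if 1 ≤ i ∧ i ≤ l.length then l.getD (l.length - i) 0 else 0

/-- The top-`k` margin `Δ_k` of `p` on the candidate set `t`:
`p_(k) − p_(k+1)` (with `p_(k+1) := 0` when `|t| = k`). -/
noncomputable def gapOn {A : Type*} (t : Finset A) (p : A → ℝ) (k : ℕ) : ℝ :=
  orderStatOn t p k - orderStatOn t p (k + 1)

/-- `S` is a top-`k` set for `p` within the candidate set `t`. -/
def IsTopKOn {A : Type*} (t : Finset A) (p : A → ℝ) (k : ℕ) (S : Finset A) : Prop :=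
  S ⊆ t ∧ S.card = k ∧ ∀ a ∈ S, ∀ b ∈ t, b ∉ S → p b ≤ p a

/-- `KL(q‖π) = Σ_{a ∈ t} q(a) log(q(a)/π(a))` on the candidate set `t`. -/
noncomputable def KLOn {A : Type*} (t : Finset A) (q π : A → ℝ) : ℝ :=
  ∑ a ∈ t, q a * Real.log (q a / π a)

theorem length_sub_le_countP_of_sortedLE {l : List ℝ} (hl : l.Pairwise (· ≤ ·)) {i : ℕ}
    (hi : i < l.length) : l.length - i ≤ l.countP (fun x => decide (l[i] ≤ x)) := by
  have hall : (l.drop i).countP (fun x => decide (l[i] ≤ x)) = (l.drop i).length := by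
    rw [List.countP_eq_length]
    intro x hx
    obtain ⟨j, hj, rfl⟩ := List.mem_iff_getElem.1 hx
    rw [List.getElem_drop]
    have hj' : i + j < l.length := by
      rw [List.length_drop] at hj
      omega
    rcases Nat.eq_zero_or_pos j with rfl | hpos
    · simp
    · simpa using List.pairwise_iff_getElem.1 hl i (i + j) hi hj' (by omega)
  rw [← List.length_drop, ← hall]
  exact (List.drop_sublist i l).countP_le

theorem countP_lt_le_of_sortedLE {l : List ℝ} (hl : l.Pairwise (· ≤ ·)) {i : ℕ}
    (hi : i < l.length) : l.countP (fun x => decide (l[i] < x)) ≤ l.length - (i + 1) := by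
  have hzero : (l.take (i + 1)).countP (fun x => decide (l[i] < x)) = 0 := by
    rw [List.countP_eq_zero]
    intro x hx
    obtain ⟨j, hj, rfl⟩ := List.mem_iff_getElem.1 hx
    rw [List.getElem_take]
    rw [List.length_take] at hj
    rcases Nat.lt_or_ge j i with hlt | hge
    · simpa using List.pairwise_iff_getElem.1 hl j i (by omega) hi hlt
    · obtain rfl : j = i := by omega
      simp
  have hsplit : l.countP (fun x => decide (l[i] < x)) =
      (l.take (i + 1)).countP (fun x => decide (l[i] < x)) +
        (l.drop (i + 1)).countP (fun x => decide (l[i] < x)) := by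
    rw [← List.countP_append, List.take_append_drop]
  rw [hsplit, hzero, zero_add, ← List.length_drop]
  exact List.countP_le_length

theorem countP_sort_map {A : Type*} (t : Finset A) (p : A → ℝ) (P : ℝ → Prop)
    [DecidablePred P] :
    ((t.val.map p).sort (· ≤ ·)).countP (fun x => decide (P x)) =
      (t.filter (fun a => P (p a))).card := by
  rw [← Multiset.coe_countP, Multiset.sort_eq, Multiset.countP_map]
  rfl

/-- At least `i` candidates lie at or above the `i`-th order statistic. -/
theorem le_card_filter_orderStatOn_le {A : Type*} (t : Finset A) (p : A → ℝ) {i : ℕ}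
    (h1 : 1 ≤ i) (hi : i ≤ t.card) :
    i ≤ (t.filter (fun a => orderStatOn t p i ≤ p a)).card := by
  have hlen : ((t.val.map p).sort (· ≤ ·)).length = t.card := by simp
  have hlt : t.card - i < ((t.val.map p).sort (· ≤ ·)).length := by omega
  have hval : orderStatOn t p i = ((t.val.map p).sort (· ≤ ·))[t.card - i] := by
    rw [← List.getD_eq_getElem _ 0 hlt, orderStatOn, hlen, if_pos ⟨h1, hi⟩]
  have hcount := length_sub_le_countP_of_sortedLE (Multiset.pairwise_sort _ _) hlt
  rw [← hval, countP_sort_map t p (fun x => orderStatOn t p i ≤ x), hlen] at hcount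
  omega

/-- Fewer than `i` candidates lie strictly above the `i`-th order statistic. -/
theorem card_filter_orderStatOn_lt {A : Type*} (t : Finset A) (p : A → ℝ) {i : ℕ}
    (h1 : 1 ≤ i) (hi : i ≤ t.card) :
    (t.filter (fun a => orderStatOn t p i < p a)).card < i := by
  have hlen : ((t.val.map p).sort (· ≤ ·)).length = t.card := by simp
  have hlt : t.card - i < ((t.val.map p).sort (· ≤ ·)).length := by omega
  have hval : orderStatOn t p i = ((t.val.map p).sort (· ≤ ·))[t.card - i] := by
    rw [← List.getD_eq_getElem _ 0 hlt, orderStatOn, hlen, if_pos ⟨h1, hi⟩]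
  have hcount := countP_lt_le_of_sortedLE (Multiset.pairwise_sort _ _) hlt
  rw [← hval, countP_sort_map t p (fun x => orderStatOn t p i < x), hlen] at hcount
  omega

theorem IsTopKOn.orderStatOn_le {A : Type*} {t : Finset A} {p : A → ℝ} {k : ℕ}
    {S : Finset A} (hS : IsTopKOn t p k S) {a : A} (ha : a ∈ S) :
    orderStatOn t p k ≤ p a := by
  classical
  obtain ⟨hsub, hcard, hmax⟩ := hS
  by_contra! hlt
  have hk : 1 ≤ k := hcard ▸ Finset.card_pos.2 ⟨a, ha⟩
  have hcount := le_card_filter_orderStatOn_le t p hk (hcard ▸ Finset.card_le_card hsub)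
  have hle : (t.filter (fun b => orderStatOn t p k ≤ p b)).card ≤ (S.erase a).card := by
    refine Finset.card_le_card fun b hb => ?_
    rw [Finset.mem_filter] at hb
    have hbS : b ∈ S := by
      by_contra hbS
      linarith [hmax a ha b hb.1 hbS]
    refine Finset.mem_erase.2 ⟨?_, hbS⟩
    rintro rfl
    linarith
  rw [Finset.card_erase_of_mem ha] at hle
  omega

theorem IsTopKOn.le_orderStatOn_succ {A : Type*} {t : Finset A} {p : A → ℝ} {k : ℕ}
    {S : Finset A} (hS : IsTopKOn t p k S) {b : A} (hb : b ∈ t) (hbS : b ∉ S) :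
    p b ≤ orderStatOn t p (k + 1) := by
  classical
  obtain ⟨hsub, hcard, hmax⟩ := hS
  by_contra! hlt
  have hins : insert b S ⊆ t.filter (fun a => orderStatOn t p (k + 1) < p a) := by
    intro a ha
    rcases Finset.mem_insert.1 ha with rfl | ha
    · exact Finset.mem_filter.2 ⟨hb, hlt⟩
    · exact Finset.mem_filter.2 ⟨hsub ha, hlt.trans_le (hmax a ha b hb hbS)⟩
  have hle := Finset.card_le_card hins
  have hle' := Finset.card_le_card (Finset.insert_subset hb hsub)
  rw [Finset.card_insert_of_notMem hbS, hcard] at hle hle'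
  have := card_filter_orderStatOn_lt t p (Nat.le_add_left 1 k) hle'
  omega

/-- Replacing a top-`k` set by any other `k`-subset of the candidates loses at least the
margin. -/
theorem IsTopKOn.gapOn_le_sum_sub_sum {A : Type*} {t : Finset A} {p : A → ℝ} {k : ℕ}
    {S S' : Finset A} (hS : IsTopKOn t p k S) (hsub : S' ⊆ t) (hcard : S'.card = k)
    (hne : S ≠ S') (hgap : 0 ≤ gapOn t p k) :
    gapOn t p k ≤ ∑ a ∈ S, p a - ∑ a ∈ S', p a := by
  classical
  have hcards : (S \ S').card = (S' \ S).card :=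
    Finset.card_sdiff_comm (hS.2.1.trans hcard.symm)
  have hpos : 1 ≤ (S \ S').card := by
    rw [Nat.one_le_iff_ne_zero, Ne, Finset.card_eq_zero, Finset.sdiff_eq_empty_iff_subset]
    exact fun h => hne (Finset.eq_of_subset_of_card_le h (by rw [hcard, hS.2.1]))
  have hlow : (S \ S').card • orderStatOn t p k ≤ ∑ a ∈ S \ S', p a :=
    Finset.card_nsmul_le_sum _ _ _ fun a ha => hS.orderStatOn_le (Finset.mem_sdiff.1 ha).1
  have hupp : ∑ a ∈ S' \ S, p a ≤ (S' \ S).card • orderStatOn t p (k + 1) :=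
    Finset.sum_le_card_nsmul _ _ _ fun a ha =>
      hS.le_orderStatOn_succ (hsub (Finset.mem_sdiff.1 ha).1) (Finset.mem_sdiff.1 ha).2
  have hdiff := Finset.sum_sdiff_sub_sum_sdiff (f := p) (s₁ := S) (s₂ := S')
  rw [← hcards] at hupp
  rw [nsmul_eq_mul] at hlow hupp
  have hone : (1 : ℝ) ≤ (S \ S').card := by exact_mod_cast hpos
  have hmul := mul_le_mul_of_nonneg_right hone hgap
  unfold gapOn at hmul ⊢
  linarith

theorem IsTopKOn.sum_le_sum {A : Type*} {t : Finset A} {p : A → ℝ} {k : ℕ}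
    {S S' : Finset A} (hS : IsTopKOn t p k S) (hsub : S' ⊆ t) (hcard : S'.card = k) :
    ∑ a ∈ S', p a ≤ ∑ a ∈ S, p a := by
  classical
  have hcards : (S \ S').card = (S' \ S).card :=
    Finset.card_sdiff_comm (hS.2.1.trans hcard.symm)
  have hdiff := Finset.sum_sdiff_sub_sum_sdiff (f := p) (s₁ := S) (s₂ := S')
  have hexch : ∑ b ∈ S' \ S, p b ≤ ∑ a ∈ S \ S', p a := by
    let e := Finset.equivOfCardEq hcards
    rw [← Finset.sum_coe_sort (S' \ S), ← Finset.sum_coe_sort (S \ S'),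
      ← e.sum_comp fun b => p b]
    exact Finset.sum_le_sum fun a _ =>
      hS.2.2 a (Finset.mem_sdiff.1 a.2).1 (e a) (hsub (Finset.mem_sdiff.1 (e a).2).1)
        (Finset.mem_sdiff.1 (e a).2).2
  linarith

theorem two_mul_sub_sqrt_le_mul_log {q r : ℝ} (hq : 0 ≤ q) (hr : 0 < r) :
    2 * (q - √q * √r) ≤ q * Real.log (q / r) := by
  rcases hq.eq_or_lt with rfl | hq
  · simp
  have hsq := Real.sqrt_pos.2 hq
  have hsr := Real.sqrt_pos.2 hr
  have hlog : Real.log (q / r) = -(2 * Real.log (√r / √q)) := by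
    rw [Real.log_div hq.ne' hr.ne', Real.log_div hsr.ne' hsq.ne', Real.log_sqrt hr.le,
      Real.log_sqrt hq.le]
    ring
  have hbound := Real.log_le_sub_one_of_pos (div_pos hsr hsq)
  have hmul : q * (√r / √q) = √q * √r := by
    rw [mul_div_left_comm, Real.div_sqrt, mul_comm]
  rw [hlog]
  nlinarith [mul_le_mul_of_nonneg_left hbound hq.le]

/-- A Pinsker-type inequality, with a constant that is not optimal. -/
theorem sq_sum_abs_sub_le_KLOn {A : Type*} {t : Finset A} {q r : A → ℝ}
    (hq : ∀ a ∈ t, 0 ≤ q a) (hr : ∀ a ∈ t, 0 < r a) (hq1 : ∑ a ∈ t, q a = 1)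
    (hr1 : ∑ a ∈ t, r a = 1) : (∑ a ∈ t, |q a - r a|) ^ 2 ≤ 4 * KLOn t q r := by
  have hsq : ∀ a ∈ t, √(q a) ^ 2 = q a := fun a ha => Real.sq_sqrt (hq a ha)
  have hsr : ∀ a ∈ t, √(r a) ^ 2 = r a := fun a ha => Real.sq_sqrt (hr a ha).le
  have hfac : ∑ a ∈ t, |q a - r a| = ∑ a ∈ t, |√(q a) - √(r a)| * (√(q a) + √(r a)) := by
    refine Finset.sum_congr rfl fun a ha => ?_
    rw [← abs_of_nonneg (add_nonneg (Real.sqrt_nonneg (q a)) (Real.sqrt_nonneg (r a))),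
      ← abs_mul]
    congr 1
    linear_combination -(hsq a ha) + hsr a ha
  have hhell : ∑ a ∈ t, |√(q a) - √(r a)| ^ 2 ≤ KLOn t q r := by
    have hsum : ∑ a ∈ t, |√(q a) - √(r a)| ^ 2 = ∑ a ∈ t, 2 * (q a - √(q a) * √(r a)) := by
      have heq : ∑ a ∈ t, |√(q a) - √(r a)| ^ 2 =
          ∑ a ∈ t, (2 * (q a - √(q a) * √(r a)) + (r a - q a)) := by
        refine Finset.sum_congr rfl fun a ha => ?_
        rw [sq_abs]
        linear_combination hsq a ha + hsr a ha
      rw [heq, Finset.sum_add_distrib, Finset.sum_sub_distrib r q, hq1, hr1]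
      ring
    rw [hsum]
    exact Finset.sum_le_sum fun a ha => two_mul_sub_sqrt_le_mul_log (hq a ha) (hr a ha)
  have hplus : ∑ a ∈ t, (√(q a) + √(r a)) ^ 2 ≤ 4 := by
    calc ∑ a ∈ t, (√(q a) + √(r a)) ^ 2 ≤ ∑ a ∈ t, (2 * q a + 2 * r a) := by
          refine Finset.sum_le_sum fun a ha => ?_
          nlinarith [sq_nonneg (√(q a) - √(r a)), hsq a ha, hsr a ha]
      _ = 4 := by
          rw [Finset.sum_add_distrib, ← Finset.mul_sum, ← Finset.mul_sum, hq1, hr1]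
          norm_num
  calc (∑ a ∈ t, |q a - r a|) ^ 2
      ≤ (∑ a ∈ t, |√(q a) - √(r a)| ^ 2) * ∑ a ∈ t, (√(q a) + √(r a)) ^ 2 := by
        rw [hfac]
        exact Finset.sum_mul_sq_le_sq_mul_sq _ _ _
    _ ≤ (∑ a ∈ t, |√(q a) - √(r a)| ^ 2) * 4 :=
        mul_le_mul_of_nonneg_left hplus (Finset.sum_nonneg fun a _ => sq_nonneg _)
    _ ≤ 4 * KLOn t q r := by linarith

theorem abs_sum_sub_sum_le {A : Type*} {t S : Finset A} (hS : S ⊆ t) (q r : A → ℝ) :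
    |∑ a ∈ S, q a - ∑ a ∈ S, r a| ≤ ∑ a ∈ t, |q a - r a| := by
  rw [← Finset.sum_sub_distrib]
  exact (Finset.abs_sum_le_sum_abs _ _).trans
    (Finset.sum_le_sum_of_subset_of_nonneg hS fun a _ _ => abs_nonneg _)

/-- The mass lost by using a top-`k` set of `r` instead of one of `q` is controlled by the
Kullback–Leibler divergence. -/
theorem IsTopKOn.sq_sum_sub_sum_le_KLOn {A : Type*} {t : Finset A} {q r : A → ℝ} {k : ℕ}
    {Sq Sr : Finset A} (hSq : IsTopKOn t q k Sq) (hSr : IsTopKOn t r k Sr)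
    (hq : ∀ a ∈ t, 0 ≤ q a) (hr : ∀ a ∈ t, 0 < r a) (hq1 : ∑ a ∈ t, q a = 1)
    (hr1 : ∑ a ∈ t, r a = 1) :
    (∑ a ∈ Sq, q a - ∑ a ∈ Sr, q a) ^ 2 ≤ 16 * KLOn t q r := by
  have hnonneg := hSq.sum_le_sum hSr.1 hSr.2.1
  have hr_le := hSr.sum_le_sum hSq.1 hSq.2.1
  have h1 := (abs_le.1 (abs_sum_sub_sum_le hSq.1 q r)).2
  have h2 := (abs_le.1 (abs_sum_sub_sum_le hSr.1 q r)).1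
  have hpinsker := sq_sum_abs_sub_le_KLOn hq hr hq1 hr1
  have hle : ∑ a ∈ Sq, q a - ∑ a ∈ Sr, q a ≤ 2 * ∑ a ∈ t, |q a - r a| := by linarith
  have hsq := pow_le_pow_left₀ (sub_nonneg.2 hnonneg) hle 2
  nlinarith

/-- On the event that the margin exceeds `u`, the lost mass is at most `16 KL / u²`. -/
theorem IsTopKOn.sum_sub_sum_le_of_lt_gapOn {A : Type*} {t : Finset A} {q r : A → ℝ} {k : ℕ}
    {Sq Sr : Finset A} (hSq : IsTopKOn t q k Sq) (hSr : IsTopKOn t r k Sr)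
    (hq : ∀ a ∈ t, 0 ≤ q a) (hr : ∀ a ∈ t, 0 < r a) (hq1 : ∑ a ∈ t, q a = 1)
    (hr1 : ∑ a ∈ t, r a = 1) {u : ℝ} (hu : 0 < u) (hgap : u < gapOn t q k) :
    ∑ a ∈ Sq, q a - ∑ a ∈ Sr, q a ≤ 16 / u ^ 2 * KLOn t q r := by
  have hKL := hSq.sq_sum_sub_sum_le_KLOn hSr hq hr hq1 hr1
  rw [div_mul_eq_mul_div, le_div_iff₀ (pow_pos hu 2)]
  by_cases hne : Sq = Sr
  · rw [hne, sub_self] at hKL ⊢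
    linarith
  have hlow := hSq.gapOn_le_sum_sub_sum hSr.1 hSr.2.1 hne (hu.trans hgap).le
  have hone : ∑ a ∈ Sq, q a ≤ 1 :=
    hq1 ▸ Finset.sum_le_sum_of_subset_of_nonneg hSq.1 fun a ha _ => hq a ha
  have hzero : 0 ≤ ∑ a ∈ Sr, q a := Finset.sum_nonneg fun a ha => hq a (hSr.1 ha)
  have hsq : u ^ 2 ≤ (∑ a ∈ Sq, q a - ∑ a ∈ Sr, q a) ^ 2 :=
    pow_le_pow_left₀ hu.le (hgap.le.trans hlow) 2
  nlinarith [mul_le_mul_of_nonneg_right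
    (show ∑ a ∈ Sq, q a - ∑ a ∈ Sr, q a ≤ 1 by linarith) (sq_nonneg u)]

theorem KLOn_nonneg {A : Type*} {t : Finset A} {q r : A → ℝ}
    (hq : ∀ a ∈ t, 0 ≤ q a) (hr : ∀ a ∈ t, 0 < r a) (hq1 : ∑ a ∈ t, q a = 1)
    (hr1 : ∑ a ∈ t, r a = 1) : 0 ≤ KLOn t q r := by
  have := sq_nonneg (∑ a ∈ t, |q a - r a|)
  linarith [sq_sum_abs_sub_le_KLOn hq hr hq1 hr1]

theorem integral_le_of_le_one_of_nonpos_off {X : Type*} [MeasurableSpace X] {ν : Measure X}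
    [IsFiniteMeasure ν] {f : X → ℝ} (hf : Integrable f ν) {E : Set X} {c : ℝ} (hc : 0 ≤ c)
    (hE : ν E ≤ ENNReal.ofReal c) (h1 : ∀ s, f s ≤ 1) (h0 : ∀ s, s ∉ E → f s ≤ 0) :
    ∫ s, f s ∂ν ≤ c := by
  have hmeas := measurableSet_toMeasurable ν E
  calc ∫ s, f s ∂ν ≤ ∫ s, (toMeasurable ν E).indicator 1 s ∂ν := by
        refine integral_mono hf ((integrable_const 1).indicator hmeas) fun s => ?_
        by_cases hs : s ∈ toMeasurable ν E
        · simpa [hs] using h1 s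
        · simpa [hs] using h0 s fun h => hs (subset_toMeasurable ν E h)
    _ = ν.real (toMeasurable ν E) := integral_indicator_one hmeas
    _ ≤ c := by
        rw [Measure.real, measure_toMeasurable]
        exact ENNReal.toReal_le_of_le_ofReal hc hE

/-- Balancing a margin term `C₀ u^β` against `16 D / u²` over `u > 0`. -/
theorem le_mul_rpow_of_forall_le_add_div {β C₀ D I : ℝ} (hβ : 0 < β)
    (hD : 0 ≤ D) (h : ∀ u : ℝ, 0 < u → I ≤ C₀ * u ^ β + 16 / u ^ 2 * D) :
    I ≤ (C₀ + 16) * D ^ (β / (β + 2)) := by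
  have hβ2 : 0 < β + 2 := by linarith
  rcases hD.eq_or_lt with rfl | hD
  · rw [Real.zero_rpow (div_pos hβ hβ2).ne', mul_zero]
    have hcont : Filter.Tendsto (fun u : ℝ => C₀ * u ^ β) (nhdsWithin 0 (Set.Ioi 0))
        (nhds (C₀ * 0 ^ β)) :=
      ((Real.continuousAt_rpow_const 0 β (Or.inr hβ.le)).tendsto.mono_left
        nhdsWithin_le_nhds).const_mul C₀
    rw [Real.zero_rpow hβ.ne', mul_zero] at hcont
    refine ge_of_tendsto hcont ?_
    filter_upwards [self_mem_nhdsWithin] with u hu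
    simpa using h u hu
  · have hbal := h (D ^ (1 / (β + 2))) (Real.rpow_pos_of_pos hD _)
    have hmargin : (D ^ (1 / (β + 2))) ^ β = D ^ (β / (β + 2)) := by
      rw [← Real.rpow_mul hD.le]
      congr 1
      ring
    have hsq : D ^ (β / (β + 2)) * (D ^ (1 / (β + 2))) ^ 2 = D := by
      rw [← Real.rpow_natCast, ← Real.rpow_mul hD.le, ← Real.rpow_add hD]
      convert Real.rpow_one D using 2
      push_cast
      field_simp
    have hdiv : 16 / (D ^ (1 / (β + 2))) ^ 2 * D = 16 * D ^ (β / (β + 2)) := by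
      have := (Real.rpow_pos_of_pos hD (1 / (β + 2))).ne'
      rw [div_mul_eq_mul_div, div_eq_iff (pow_ne_zero 2 this), mul_assoc, hsq]
    rw [hmargin, hdiv] at hbal
    linarith

/-- A union bound: an event off which the integrable `f ≥ 0` is at least `1` has probability
at least `1 - E[f]`. -/
theorem ofReal_one_sub_integral_le_measure {Ω : Type*} [MeasurableSpace Ω] {μ : Measure Ω}
    [IsProbabilityMeasure μ] {f : Ω → ℝ} (hf : Integrable f μ) (h0 : ∀ ω, 0 ≤ f ω)
    {B : Set Ω} (h1 : ∀ ω, ω ∉ B → 1 ≤ f ω) :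
    ENNReal.ofReal (1 - ∫ ω, f ω ∂μ) ≤ μ B := by
  have hcompl : μ Bᶜ ≤ ENNReal.ofReal (∫ ω, f ω ∂μ) := by
    calc μ Bᶜ ≤ μ {ω | 1 ≤ f ω} := measure_mono h1
      _ = ENNReal.ofReal (μ.real {ω | 1 ≤ f ω}) := (ENNReal.ofReal_toReal (measure_ne_top _ _)).symm
      _ ≤ ENNReal.ofReal (∫ ω, f ω ∂μ) := by
        have := mul_meas_ge_le_integral_of_nonneg (.of_forall h0) hf 1
        exact ENNReal.ofReal_le_ofReal (by simpa using this)
  rw [ENNReal.ofReal_sub _ (integral_nonneg h0), ENNReal.ofReal_one]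
  refine tsub_le_iff_right.2 ?_
  calc (1 : ENNReal) = μ Set.univ := measure_univ.symm
    _ ≤ μ B + μ Bᶜ := measure_univ_le_add_compl B
    _ ≤ μ B + ENNReal.ofReal (∫ ω, f ω ∂μ) := by gcongr

theorem sum_mul_ite_notMem {A : Type*} {t S : Finset A} [DecidableEq A] (hS : S ⊆ t)
    (q : A → ℝ) (hq1 : ∑ a ∈ t, q a = 1) :
    ∑ a ∈ t, q a * (if a ∈ S then 0 else 1) = 1 - ∑ a ∈ S, q a := by
  have hsplit := Finset.sum_sdiff (f := q) hS
  have heq : ∑ a ∈ t, q a * (if a ∈ S then 0 else 1) = ∑ a ∈ t \ S, q a := by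
    rw [Finset.sdiff_eq_filter, Finset.sum_filter]
    exact Finset.sum_congr rfl fun a _ => by by_cases h : a ∈ S <;> simp [h]
  rw [heq]
  linarith

/-- **Top-`k` success under a Tsybakov margin condition (flat case).**
Consider a deterministic proving MDP `(F, G)` with horizon `T`, a distribution `Q`
(modelled by a probability space `(Ω, μ)` carrying a random length `L ≤ T`, random
states `S`, and random actions `Act`) over successful traces (`S_L ∈ G`, transitions
respected), with candidate sets `Γ(s)` of size `M` and restricted generator conditional
`qΓ(·|s)`; `K = E[L]`; `ν` the time-mixture state law, expressed by the identity
`E_μ[Σ_{t<L} g(S_t, Act_t)] = K · E_ν[Σ_{a∈Γ(S)} qΓ(a|S) g(S,a)]` for bounded `g`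
(this identity encodes both the time-mixture definition of `ν` and the conditional
action law `A_t ∼ qΓ(·|S_t)`).  Under the margin condition
`ν(Δ_k(qΓ(·|S)) ≤ u) ≤ C₀ u^β`, for any policy `π` (given by its restricted
normalization `πΓ` and measurable top-`k` selections `Sπ`, resp. `Sq` for `qΓ`),
the probability of the coverage event `{∀ t < L, Act_t ∈ Top_k(π(·|S_t))}` is at least
`1 − K·E_ν[1 − m_k(qΓ(·|S))] − K·C·KL̄(π)^{β/(β+2)}`
where `KL̄(π) = E_ν[KL(qΓ(·|S)‖πΓ(·|S))]` and `C` depends only on `β` and `C₀`.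
(In particular any top-`k` proof search succeeding whenever the coverage event holds
has at least this success probability.) -/
theorem stmt13 {X A : Type*} [MeasurableSpace X]
    (β C₀ : ℝ) (hβ : 0 < β) (hC₀ : 0 < C₀) :
    ∃ C : ℝ, 0 < C ∧
      ∀ (F : X → A → X) (G : Set X) (T M k : ℕ), 1 ≤ k → k ≤ M →
      ∀ (Γ : X → Finset A), (∀ s, (Γ s).card = M) →
      ∀ (qΓ πΓ : X → A → ℝ),
        (∀ s, (∀ a, 0 ≤ qΓ s a) ∧ (∑ a ∈ Γ s, qΓ s a) = 1) →
        (∀ s, (∀ a ∈ Γ s, 0 < πΓ s a) ∧ (∑ a ∈ Γ s, πΓ s a) = 1) →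
      ∀ (Sq Sπ : X → Finset A),
        (∀ s, IsTopKOn (Γ s) (qΓ s) k (Sq s)) →
        (∀ s, IsTopKOn (Γ s) (πΓ s) k (Sπ s)) →
      ∀ (Ω : Type) (mΩ : MeasurableSpace Ω) (μ : Measure Ω), IsProbabilityMeasure μ →
      ∀ (L : Ω → ℕ) (S : Ω → ℕ → X) (Act : Ω → ℕ → A),
        (∀ ω, L ω ≤ T ∧ S ω (L ω) ∈ G ∧
          ∀ t < L ω, S ω (t + 1) = F (S ω t) (Act ω t)) →
      ∀ K : ℝ, 0 < K → K = ∫ ω, (L ω : ℝ) ∂μ →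
      ∀ ν : Measure X, IsProbabilityMeasure ν →
        (∀ g : X → A → ℝ, (∀ s a, |g s a| ≤ 1) →
          Integrable (fun ω => ∑ t ∈ Finset.range (L ω), g (S ω t) (Act ω t)) μ ∧
          Integrable (fun s => ∑ a ∈ Γ s, qΓ s a * g s a) ν ∧
          (∫ ω, (∑ t ∈ Finset.range (L ω), g (S ω t) (Act ω t)) ∂μ)
            = K * ∫ s, (∑ a ∈ Γ s, qΓ s a * g s a) ∂ν) →
        (∀ u : ℝ, 0 < u →
          ν {s | gapOn (Γ s) (qΓ s) k ≤ u} ≤ ENNReal.ofReal (C₀ * u ^ β)) →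
        Integrable (fun s => KLOn (Γ s) (qΓ s) (πΓ s)) ν →
      ENNReal.ofReal
          (1 - K * (∫ s, (1 - ∑ a ∈ Sq s, qΓ s a) ∂ν)
             - K * C * (∫ s, KLOn (Γ s) (qΓ s) (πΓ s) ∂ν) ^ (β / (β + 2)))
        ≤ μ {ω | ∀ t < L ω, Act ω t ∈ Sπ (S ω t)} := by
  classical
  refine ⟨C₀ + 16, by linarith, ?_⟩
  intro F G T M k _ _ Γ _ qΓ πΓ hq hπ Sq Sπ hSq hSπ Ω mΩ μ hμ L S Act _ K hK _ ν hν hmix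
    hmargin hKLint
  have hKL0 : ∀ s, 0 ≤ KLOn (Γ s) (qΓ s) (πΓ s) := fun s =>
    KLOn_nonneg (fun a _ => (hq s).1 a) (hπ s).1 (hq s).2 (hπ s).2
  have hbdd : ∀ (U : X → Finset A) (s : X) (a : A),
      |(if a ∈ U s then (0 : ℝ) else 1)| ≤ 1 := by
    intro U s a
    split_ifs <;> simp
  obtain ⟨hsum_int, hπ_int, hsum_eq⟩ := hmix _ (hbdd Sπ)
  obtain ⟨-, hq_int, -⟩ := hmix _ (hbdd Sq)
  simp only [fun s => sum_mul_ite_notMem (hSπ s).1 (qΓ s) (hq s).2] at hπ_int hsum_eq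
  simp only [fun s => sum_mul_ite_notMem (hSq s).1 (qΓ s) (hq s).2] at hq_int
  have hdiff_int : Integrable
      (fun s => (1 - ∑ a ∈ Sπ s, qΓ s a) - (1 - ∑ a ∈ Sq s, qΓ s a)) ν := hπ_int.sub hq_int
  have hloss : ∫ s, (1 - ∑ a ∈ Sπ s, qΓ s a) ∂ν - ∫ s, (1 - ∑ a ∈ Sq s, qΓ s a) ∂ν
      ≤ (C₀ + 16) * (∫ s, KLOn (Γ s) (qΓ s) (πΓ s) ∂ν) ^ (β / (β + 2)) := by
    refine le_mul_rpow_of_forall_le_add_div hβ (integral_nonneg hKL0) fun u hu => ?_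
    rw [← sub_le_iff_le_add, ← integral_sub hπ_int hq_int, ← integral_const_mul,
      ← integral_sub hdiff_int (hKLint.const_mul _)]
    refine integral_le_of_le_one_of_nonpos_off (hdiff_int.sub (hKLint.const_mul _))
      (mul_nonneg hC₀.le (Real.rpow_nonneg hu.le β)) (hmargin u hu) (fun s => ?_)
      fun s hs => ?_
    · have hone : ∑ a ∈ Sq s, qΓ s a ≤ 1 :=
        (hq s).2 ▸ Finset.sum_le_sum_of_subset_of_nonneg (hSq s).1 fun a _ _ => (hq s).1 a
      have hzero : 0 ≤ ∑ a ∈ Sπ s, qΓ s a := Finset.sum_nonneg fun a _ => (hq s).1 a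
      have hterm : 0 ≤ 16 / u ^ 2 * KLOn (Γ s) (qΓ s) (πΓ s) :=
        mul_nonneg (by positivity) (hKL0 s)
      simp only [Pi.sub_apply]
      linarith
    · have := (hSq s).sum_sub_sum_le_of_lt_gapOn (hSπ s) (fun a _ => (hq s).1 a) (hπ s).1
        (hq s).2 (hπ s).2 hu (not_le.1 hs)
      simp only [Pi.sub_apply]
      linarith
  refine le_trans (ENNReal.ofReal_le_ofReal ?_)
    (ofReal_one_sub_integral_le_measure hsum_int (fun ω => ?_) fun ω hω => ?_)
  · rw [hsum_eq]
    linarith [mul_le_mul_of_nonneg_left hloss hK.le]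
  · exact Finset.sum_nonneg fun t _ => by split_ifs <;> norm_num
  · simp only [Set.mem_ofPred_eq, not_forall] at hω
    obtain ⟨t, ht, hmem⟩ := hω
    calc (1 : ℝ) = if Act ω t ∈ Sπ (S ω t) then 0 else 1 := (if_neg hmem).symm
      _ ≤ _ := Finset.single_le_sum
          (f := fun t => if Act ω t ∈ Sπ (S ω t) then (0 : ℝ) else 1)
          (fun t _ => by split_ifs <;> norm_num) (Finset.mem_range.2 ht)
end
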